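/- For all integers m, t ≥ 1 there exists a constant C = C(m,t) > 0 with the following property. Let β, α₁,…,αₜ ∈ ℝ, let ζ, γ₁,…,γₜ ∈ ℝ^m, let 0 < δ < 1/2, let N ≥ 1 be a real number and N₁,…,Nₜ ≥ 1 integers. Suppose that |ζ| ≤ 1/δ and that ‖β + Σ_{j=1}^t αⱼhⱼ + ζ·{Σ_{j=1}^t γⱼhⱼ}‖_{ℝ/ℤ} ≤ 1/(δN) for at least δ·N₁⋯Nₜ values of h⃗ ∈ [−N⃗, N⃗]. Then at least one of the following holds: (i) there is r ∈ ℤ with 0 < r ≤ C·δ^{−C} such that ‖r·ζ_l‖_{ℝ/ℤ} ≤ C·δ^{−C}/N for all l = 1,…,m; (ii) there exists k ∈ ℤ^m with 0 < |k| ≤ C·δ^{−C} such that ‖k·γⱼ‖_{ℝ/ℤ} ≤ C·δ^{−C}/Nⱼ for all j = 1,…,t. -/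

import Mathlib

open scoped Classical

/-- `fracNorm x` is the distance from `x` to the nearest integer, `‖x‖_{ℝ/ℤ}`. -/
noncomputable def fracNorm (x : ℝ) : ℝ := |x - round x|

theorem fracNorm_nonneg (x : ℝ) : 0 ≤ fracNorm x := abs_nonneg _

theorem fracNorm_le_half (x : ℝ) : fracNorm x ≤ 1 / 2 := abs_sub_round x

theorem fracNorm_le (x : ℝ) (n : ℤ) : fracNorm x ≤ |x - n| := round_le x n

theorem fracNorm_neg (x : ℝ) : fracNorm (-x) = fracNorm x := by
  have key : ∀ y : ℝ, fracNorm (-y) ≤ fracNorm y := fun y => by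
    refine (fracNorm_le (-y) (-round y)).trans_eq ?_
    rw [fracNorm, ← abs_neg]
    push_cast
    ring_nf
  exact le_antisymm (key x) (by simpa using key (-x))

theorem fracNorm_add_le (x y : ℝ) : fracNorm (x + y) ≤ fracNorm x + fracNorm y := by
  refine (fracNorm_le (x + y) (round x + round y)).trans ?_
  refine le_trans (le_of_eq ?_) (abs_add_le (x - round x) (y - round y))
  push_cast
  ring_nf

theorem fracNorm_sub_le (x y : ℝ) : fracNorm (x - y) ≤ fracNorm x + fracNorm y := by
  rw [sub_eq_add_neg, ← fracNorm_neg y]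
  exact fracNorm_add_le _ _

theorem fracNorm_natCast_mul_le (n : ℕ) (x : ℝ) : fracNorm (n * x) ≤ n * fracNorm x := by
  refine (fracNorm_le (n * x) (n * round x)).trans_eq ?_
  rw [fracNorm, ← Nat.abs_cast n, ← abs_mul, Nat.abs_cast]
  push_cast
  ring_nf

/-- The additive character `x ↦ exp (2πix)` of `ℝ/ℤ`. -/
noncomputable def expChar (x : ℝ) : ℂ := Complex.exp (Complex.I * ((2 * Real.pi * x : ℝ) : ℂ))

theorem expChar_add (x y : ℝ) : expChar (x + y) = expChar x * expChar y := by
  rw [expChar, expChar, expChar, ← Complex.exp_add]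
  push_cast
  ring_nf

theorem expChar_zero : expChar 0 = 1 := by simp [expChar]

theorem norm_expChar (x : ℝ) : ‖expChar x‖ = 1 := by
  rw [expChar, mul_comm, Complex.norm_exp_ofReal_mul_I]

theorem conj_expChar (x : ℝ) : (starRingEnd ℂ) (expChar x) = expChar (-x) := by
  rw [expChar, expChar, ← Complex.exp_conj]
  simp only [map_mul, Complex.conj_I, Complex.conj_ofReal]
  push_cast
  ring_nf

theorem expChar_natCast_mul (n : ℕ) (x : ℝ) : expChar (n * x) = expChar x ^ n := by
  rw [expChar, expChar, ← Complex.exp_nat_mul]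
  push_cast
  ring_nf

theorem expChar_sum {ι : Type*} (s : Finset ι) (f : ι → ℝ) :
    expChar (∑ i ∈ s, f i) = ∏ i ∈ s, expChar (f i) := by
  induction s using Finset.induction_on with
  | empty => simp [expChar_zero]
  | insert a s ha ih => rw [Finset.sum_insert ha, Finset.prod_insert ha, expChar_add, ih]

theorem expChar_add_intCast (x : ℝ) (n : ℤ) : expChar (x + n) = expChar x := by
  rw [expChar_add]
  have : expChar n = 1 := by
    rw [expChar, Complex.exp_eq_one_iff]
    exact ⟨n, by push_cast; ring⟩
  rw [this, mul_one]

theorem four_mul_fracNorm_le (x : ℝ) : 4 * fracNorm x ≤ ‖expChar x - 1‖ := by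
  have h1 : expChar x = expChar (x - round x) := by
    conv_lhs => rw [← sub_add_cancel x (round x : ℝ), expChar_add_intCast]
  rw [h1, expChar, Complex.norm_exp_I_mul_ofReal_sub_one, fracNorm]
  have h2 := abs_sub_round x
  set y := x - round x
  have hpi := Real.pi_pos
  have h3 : 2 * |y| ≤ Real.sin (Real.pi * |y|) := by
    have := Real.mul_le_sin (x := Real.pi * |y|) (by positivity) (by nlinarith)
    refine le_trans (le_of_eq ?_) this
    field_simp
  have h4 : ‖2 * Real.sin (2 * Real.pi * y / 2)‖ = 2 * |Real.sin (Real.pi * |y|)| := by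
    rw [norm_mul, Real.norm_eq_abs, Real.norm_eq_abs, abs_two,
      show 2 * Real.pi * y / 2 = Real.pi * y by ring]
    congr 1
    rcases abs_choice y with h | h <;> rw [h]
    rw [mul_neg, Real.sin_neg, abs_neg]
  rw [h4]
  have := le_abs_self (Real.sin (Real.pi * |y|))
  linarith

theorem norm_one_add_expChar_sq_le (x : ℝ) :
    ‖(1 + expChar x) / 2‖ ^ 2 ≤ 1 - 4 * fracNorm x ^ 2 := by
  have h1 := parallelogram_law_with_norm ℝ (1 : ℂ) (expChar x)
  have h2 := four_mul_fracNorm_le x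
  have h3 := fracNorm_nonneg x
  rw [norm_expChar, norm_one, norm_sub_rev] at h1
  rw [norm_div, div_pow]
  have : ‖(2 : ℂ)‖ = 2 := by simp
  rw [this]
  nlinarith [norm_nonneg (expChar x - 1)]

theorem norm_geom_sum_expChar_le (x : ℝ) (M : ℕ) :
    ‖∑ h ∈ Finset.range M, expChar (h * x)‖ * (2 * fracNorm x) ≤ 1 := by
  have h1 : (∑ h ∈ Finset.range M, expChar (h * x)) * (expChar x - 1) = expChar (M * x) - 1 := by
    simp_rw [expChar_natCast_mul]
    exact geom_sum_mul _ _
  have h2 := congrArg norm h1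
  have h3 := norm_sub_le (expChar (M * x)) 1
  rw [norm_mul] at h2
  rw [norm_expChar, norm_one] at h3
  have h4 := mul_le_mul_of_nonneg_left (four_mul_fracNorm_le x)
    (norm_nonneg (∑ h ∈ Finset.range M, expChar (h * x)))
  linarith

/-- A box exponential sum is small as soon as one of its frequencies is far from `ℤ`. -/
theorem norm_box_sum_expChar_le {t : ℕ} (M : Fin t → ℕ) (θ : Fin t → ℝ) (κ : ℝ) (j : Fin t)
    (hj : 1 ≤ 2 * κ * M j * fracNorm (θ j)) :
    ‖∑ h ∈ Fintype.piFinset (fun i => Finset.range (M i)), expChar (∑ i, h i * θ i)‖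
      ≤ κ * ∏ i, (M i : ℝ) := by
  simp_rw [expChar_sum]
  rw [← Finset.prod_univ_sum (fun i => Finset.range (M i)) (fun i h => expChar (h * θ i)),
    norm_prod, ← Finset.mul_prod_erase _ _ (Finset.mem_univ j),
    ← Finset.mul_prod_erase _ (fun i => (M i : ℝ)) (Finset.mem_univ j), ← mul_assoc]
  refine mul_le_mul ?_ (Finset.prod_le_prod (fun _ _ => norm_nonneg _) fun i _ => ?_)
    (Finset.prod_nonneg fun _ _ => norm_nonneg _) ?_
  · have h1 := norm_geom_sum_expChar_le (θ j) (M j)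
    have h2 := fracNorm_nonneg (θ j)
    have h3 : 0 < fracNorm (θ j) := by
      rcases h2.eq_or_lt with h | h
      · rw [← h] at hj; norm_num at hj
      · exact h
    refine le_of_mul_le_mul_right (h1.trans (hj.trans_eq ?_)) (by linarith : 0 < 2 * fracNorm (θ j))
    ring
  · refine (norm_sum_le _ _).trans ?_
    simp [norm_expChar]
  · by_contra h
    have := mul_nonneg (by linarith : 0 ≤ -(κ * M j)) (fracNorm_nonneg (θ j))
    linarith

/-- Large sieve type lower bound: a mean square of a weighted exponential sum is at least its
diagonal contribution, up to the size of the off-diagonal correlations. -/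
theorem card_mul_sub_le_sum_norm_sq {ι : Type*} {m : ℕ} (H : Finset ι) (V : Finset (Fin m → ℕ))
    (y : ι → Fin m → ℝ) (w : (Fin m → ℕ) → ℝ) (κ : ℝ) (hκ : 0 ≤ κ) (hw : ∀ v ∈ V, 0 ≤ w v)
    (hw1 : ∑ v ∈ V, w v = 1)
    (hoff : ∀ v ∈ V, ∀ v' ∈ V, v ≠ v' →
      ‖∑ h ∈ H, expChar (∑ l, ((v l : ℝ) - v' l) * y h l)‖ ≤ κ * H.card) :
    H.card * (∑ v ∈ V, w v ^ 2 - κ)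
      ≤ ∑ h ∈ H, ‖∑ v ∈ V, (w v : ℂ) * expChar (∑ l, v l * y h l)‖ ^ 2 := by
  set Z : (Fin m → ℕ) → (Fin m → ℕ) → ℂ := fun v v' =>
    ∑ h ∈ H, expChar (∑ l, ((v l : ℝ) - v' l) * y h l) with hZ
  have hexp : ((∑ h ∈ H, ‖∑ v ∈ V, (w v : ℂ) * expChar (∑ l, v l * y h l)‖ ^ 2 : ℝ) : ℂ)
      = ∑ v ∈ V, ∑ v' ∈ V, ((w v * w v' : ℝ) : ℂ) * Z v v' := by
    simp only [hZ, Finset.mul_sum]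
    push_cast
    have h1 : ∀ h ∈ H, (‖∑ v ∈ V, (w v : ℂ) * expChar (∑ l, v l * y h l)‖ : ℂ) ^ 2
        = ∑ v ∈ V, ∑ v' ∈ V, (w v * w v' : ℂ) * expChar (∑ l, ((v l : ℝ) - v' l) * y h l) := by
      intro h _
      rw [← Complex.mul_conj', map_sum, Finset.sum_mul_sum]
      refine Finset.sum_congr rfl fun v _ => Finset.sum_congr rfl fun v' _ => ?_
      rw [map_mul, Complex.conj_ofReal, conj_expChar, mul_mul_mul_comm, ← expChar_add]
      congr 2
      rw [← sub_eq_add_neg, ← Finset.sum_sub_distrib]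
      exact Finset.sum_congr rfl fun l _ => by ring
    rw [Finset.sum_congr rfl h1, Finset.sum_comm]
    exact Finset.sum_congr rfl fun v _ => Finset.sum_comm
  have hre := congrArg Complex.re hexp
  rw [Complex.ofReal_re, Complex.re_sum] at hre
  simp_rw [Complex.re_sum, Complex.re_ofReal_mul] at hre
  rw [hre]
  have hpt : ∀ v ∈ V, ∀ v' ∈ V,
      w v * w v' * (H.card * ((if v = v' then 1 else 0) - κ)) ≤ w v * w v' * (Z v v').re := by
    intro v hv v' hv'
    refine mul_le_mul_of_nonneg_left ?_ (mul_nonneg (hw v hv) (hw v' hv'))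
    split_ifs with h
    · subst h
      simp only [hZ, sub_self, zero_mul, Finset.sum_const_zero, expChar_zero]
      simp only [Finset.sum_const, nsmul_eq_mul, mul_one, Complex.natCast_re]
      nlinarith [Nat.cast_nonneg (α := ℝ) H.card]
    · have h1 := hoff v hv v' hv' h
      have h2 := (abs_le.mp (Complex.abs_re_le_norm (Z v v'))).1
      simp only [hZ] at h2 ⊢
      linarith
  refine le_trans (le_of_eq ?_) (Finset.sum_le_sum fun v hv => Finset.sum_le_sum (hpt v hv))
  have h2 : ∀ v ∈ V, ∑ v' ∈ V, w v * w v' * (H.card * ((if v = v' then 1 else 0) - κ))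
      = H.card * (w v ^ 2 - κ * w v) := by
    intro v hv
    have : ∀ v' ∈ V, w v * w v' * (H.card * ((if v = v' then 1 else 0) - κ))
        = H.card * w v * (if v = v' then w v' else 0) - H.card * κ * w v * w v' := by
      intro v' _
      split_ifs <;> ring
    rw [Finset.sum_congr rfl this, Finset.sum_sub_distrib, ← Finset.mul_sum, ← Finset.mul_sum,
      hw1, Finset.sum_ite_eq, if_pos hv]
    ring
  rw [Finset.sum_congr rfl h2, ← Finset.mul_sum, Finset.sum_sub_distrib, ← Finset.mul_sum, hw1,
    mul_one]

/-- Quantitative Kronecker theorem: if no small nonzero integer combination of the `γ j` is close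
to `ℤ`, then every point of the torus is approximated by some `∑ j, h j • γ j` with `h` in a
box. -/
theorem exists_fracNorm_le_of_no_relation {m t : ℕ} (γ : Fin t → Fin m → ℝ) (x : Fin m → ℝ)
    (M : Fin t → ℕ) (hM : ∀ j, 0 < M j) (n : ℕ) (ρ κ : ℝ) (hρ : 0 < ρ) (hκ : 0 ≤ κ)
    (hn : (1 - 4 * ρ ^ 2) ^ n + κ < 1 / (n + 1 : ℝ) ^ m)
    (hk : ∀ k : Fin m → ℤ, k ≠ 0 → (∀ l, |k l| ≤ n) →
      ∃ j, 1 ≤ 2 * κ * M j * fracNorm (∑ l, k l * γ j l)) :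
    ∃ h : Fin t → ℕ, (∀ j, h j < M j) ∧ ∀ l, fracNorm (∑ j, γ j l * h j - x l) ≤ ρ := by
  by_contra! hcon
  set H := Fintype.piFinset (fun j => Finset.range (M j)) with hH
  set V := Fintype.piFinset (fun _ : Fin m => Finset.range (n + 1)) with hV
  set w : (Fin m → ℕ) → ℝ := fun v => ∏ l, (n.choose (v l) : ℝ) / 2 ^ n with hw
  set y : (Fin t → ℕ) → Fin m → ℝ := fun h l => ∑ j, γ j l * h j - x l with hy
  have hw0 : ∀ v ∈ V, 0 ≤ w v := fun v _ => Finset.prod_nonneg fun _ _ => by positivity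
  have hw1 : ∑ v ∈ V, w v = 1 := by
    rw [hV, hw, ← Finset.prod_univ_sum (fun _ : Fin m => Finset.range (n + 1))
      (fun _ a => (n.choose a : ℝ) / 2 ^ n)]
    refine Finset.prod_eq_one fun _ _ => ?_
    rw [← Finset.sum_div, ← Nat.cast_sum, Nat.sum_range_choose]
    push_cast
    exact div_self (by positivity)
  have hVcard : (V.card : ℝ) = (n + 1 : ℝ) ^ m := by
    simp [hV, Fintype.card_piFinset]
  have hHcard : (H.card : ℝ) = ∏ j, (M j : ℝ) := by
    simp [hH, Fintype.card_piFinset]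
  have hHpos : (0 : ℝ) < H.card := by
    rw [hHcard]
    exact Finset.prod_pos fun j _ => Nat.cast_pos.mpr (hM j)
  have hw2 : 1 / (n + 1 : ℝ) ^ m ≤ ∑ v ∈ V, w v ^ 2 := by
    have := sq_sum_le_card_mul_sum_sq (s := V) (f := w)
    rw [hw1, hVcard] at this
    rw [div_le_iff₀' (by positivity)]
    linarith
  have hS : ∀ h, ∑ v ∈ V, (w v : ℂ) * expChar (∑ l, v l * y h l)
      = ∏ l, ((1 + expChar (y h l)) / 2) ^ n := by
    intro h
    have h1 : ∀ l, ((1 + expChar (y h l)) / 2) ^ n = ∑ a ∈ Finset.range (n + 1),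
        ((n.choose a / 2 ^ n : ℝ) : ℂ) * expChar (a * y h l) := by
      intro l
      rw [div_pow, add_comm, add_pow, Finset.sum_div]
      refine Finset.sum_congr rfl fun a _ => ?_
      rw [expChar_natCast_mul]
      push_cast
      ring
    simp_rw [h1]
    rw [Finset.prod_univ_sum]
    refine Finset.sum_congr rfl fun v _ => ?_
    rw [expChar_sum, Finset.prod_mul_distrib, hw]
    push_cast
    rfl
  have hup : ∀ h ∈ H, ‖∑ v ∈ V, (w v : ℂ) * expChar (∑ l, v l * y h l)‖ ^ 2
      ≤ (1 - 4 * ρ ^ 2) ^ n := by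
    intro h hh
    obtain ⟨l, hl⟩ := hcon h fun j => by simpa [hH] using Fintype.mem_piFinset.mp hh j
    rw [hS, norm_prod, ← Finset.prod_pow, ← Finset.mul_prod_erase _ _ (Finset.mem_univ l)]
    have hle : ∀ i, (‖((1 + expChar (y h i)) / 2) ^ n‖) ^ 2
        ≤ (1 - 4 * fracNorm (y h i) ^ 2) ^ n := by
      intro i
      rw [norm_pow, ← pow_mul, mul_comm n, pow_mul]
      exact pow_le_pow_left₀ (by positivity) (norm_one_add_expChar_sq_le _) n
    have hb : ∀ i, 0 ≤ 1 - 4 * fracNorm (y h i) ^ 2 := fun i => by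
      nlinarith [fracNorm_nonneg (y h i), fracNorm_le_half (y h i)]
    have h1 : (‖((1 + expChar (y h l)) / 2) ^ n‖) ^ 2 ≤ (1 - 4 * ρ ^ 2) ^ n :=
      (hle l).trans (pow_le_pow_left₀ (hb l) (by simp only [hy]; nlinarith) n)
    refine (mul_le_of_le_one_right (by positivity) ?_).trans h1
    refine Finset.prod_le_one (fun _ _ => by positivity) fun i _ => (hle i).trans ?_
    exact pow_le_one₀ (hb i) (by nlinarith [sq_nonneg (fracNorm (y h i))])
  have hoff : ∀ v ∈ V, ∀ v' ∈ V, v ≠ v' →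
      ‖∑ h ∈ H, expChar (∑ l, ((v l : ℝ) - v' l) * y h l)‖ ≤ κ * H.card := by
    intro v hv v' hv' hne
    have hvn : ∀ l, v l ≤ n := fun l => by
      have := Fintype.mem_piFinset.mp hv l
      rw [Finset.mem_range] at this; omega
    have hvn' : ∀ l, v' l ≤ n := fun l => by
      have := Fintype.mem_piFinset.mp hv' l
      rw [Finset.mem_range] at this; omega
    obtain ⟨j, hj⟩ := hk (fun l => (v l : ℤ) - v' l)
      (fun h => hne (funext fun l => by have := congrFun h l; simp at this; omega))
      (fun l => by have := hvn l; have := hvn' l; rw [abs_le]; constructor <;> omega)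
    push_cast at hj
    have hsplit : ∀ h : Fin t → ℕ, expChar (∑ l, ((v l : ℝ) - v' l) * y h l)
        = expChar (∑ j, h j * ∑ l, ((v l : ℝ) - v' l) * γ j l)
          * expChar (-∑ l, ((v l : ℝ) - v' l) * x l) := by
      intro h
      rw [← expChar_add]
      congr 1
      simp only [hy, mul_sub, Finset.sum_sub_distrib, Finset.mul_sum, ← sub_eq_add_neg]
      rw [Finset.sum_comm]
      congr 1
      exact Finset.sum_congr rfl fun i _ => Finset.sum_congr rfl fun l _ => by ring
    simp_rw [hsplit]
    rw [← Finset.sum_mul, norm_mul, norm_expChar, mul_one, hHcard]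
    exact norm_box_sum_expChar_le M (fun j => ∑ l, ((v l : ℝ) - v' l) * γ j l) κ j hj
  have h1 := card_mul_sub_le_sum_norm_sq H V y w κ hκ hw0 hw1 hoff
  have h2 := Finset.sum_le_card_nsmul H _ _ hup
  rw [nsmul_eq_mul] at h2
  have h3 := le_of_mul_le_mul_left (h1.trans h2) hHpos
  linarith

/-- Pigeonhole recurrence for a bracket-linear phase which is nearly integral on a dense set `B`:
for every small `u` whose image under `γ` is close to an integer point `v`, a bounded multiple of
the increment of the phase along `(u, v)` is nearly integral. -/
theorem exists_natCast_mul_increment_fracNorm_le {m t : ℕ} (β : ℝ) (α : Fin t → ℝ)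
    (ζ : Fin m → ℝ) (γ : Fin t → Fin m → ℝ) (ε : ℝ) (Nv : Fin t → ℕ) (hN : ∀ j, 1 ≤ Nv j)
    (B : Finset (Fin t → ℤ))
    (hB : B ⊆ Finset.Icc (fun j => -(Nv j : ℤ)) (fun j => (Nv j : ℤ)))
    (hf : ∀ h ∈ B, fracNorm (β + (∑ j, α j * (h j : ℝ))
      + ∑ l, ζ l * Int.fract (∑ j, γ j l * (h j : ℝ))) ≤ ε)
    (J : ℕ) (hJ : (5 : ℝ) ^ t * 3 ^ m * ∏ j, (Nv j : ℝ) < B.card * (J + 1))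
    (u : Fin t → ℤ) (v : Fin m → ℤ) (hu : ∀ j, J * |u j| ≤ Nv j)
    (hv : ∀ l, J * |∑ j, γ j l * (u j : ℝ) - v l| ≤ 1) :
    ∃ q : ℕ, 0 < q ∧ q ≤ J ∧
      fracNorm (q * (∑ j, α j * (u j : ℝ) + ∑ l, ζ l * (∑ j, γ j l * (u j : ℝ) - v l)))
        ≤ 2 * ε := by
  set Γ : Fin m → (Fin t → ℤ) → ℝ := fun l h => ∑ j, γ j l * (h j : ℝ) with hΓ
  set g : (Fin t → ℤ) × ℕ → (Fin t → ℤ) × (Fin m → ℤ) := fun p =>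
    (fun j => p.1 j + p.2 * u j,
      fun l => ⌊Γ l p.1⌋ + p.2 * v l - ⌊Γ l (fun j => p.1 j + p.2 * u j)⌋) with hg
  have hΓadd : ∀ l (h : Fin t → ℤ) (i : ℕ),
      Γ l (fun j => h j + i * u j) = Γ l h + i * Γ l u := by
    intro l h i
    simp only [hΓ, Finset.mul_sum]
    rw [← Finset.sum_add_distrib]
    exact Finset.sum_congr rfl fun j _ => by push_cast; ring
  set T := (Finset.Icc (fun j => -(2 * Nv j : ℤ)) (fun j => (2 * Nv j : ℤ))) ×ˢ
    (Finset.Icc (fun _ : Fin m => (-1 : ℤ)) (fun _ => 1)) with hT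
  have hcard : T.card < (B ×ˢ Finset.range (J + 1)).card := by
    rw [Finset.card_product B, Finset.card_range, hT, Finset.card_product, Pi.card_Icc, Pi.card_Icc]
    simp only [Int.card_Icc]
    have h1 : ∀ j, (2 * (Nv j : ℤ) + 1 - -(2 * Nv j)).toNat ≤ 5 * Nv j := fun j => by
      have := hN j; omega
    have h2 : ((1 : ℤ) + 1 - -1).toNat = 3 := rfl
    have h3 := Finset.prod_le_prod' (s := Finset.univ) fun j _ => h1 j
    rw [Finset.prod_mul_distrib] at h3
    simp only [h2, Finset.prod_const, Finset.card_univ, Fintype.card_fin] at h3 ⊢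
    refine (Nat.mul_le_mul_right (3 ^ m) h3).trans_lt ?_
    have h4 : (5 : ℝ) ^ t * (∏ j, (Nv j : ℝ)) * 3 ^ m < B.card * (J + 1) :=
      lt_of_eq_of_lt (by ring) hJ
    exact_mod_cast h4
  have hmaps : Set.MapsTo g (B ×ˢ Finset.range (J + 1) : Finset _) T := by
    rintro ⟨h, i⟩ hp
    simp only [Finset.coe_product, Set.mem_prod, Finset.mem_coe, Finset.mem_range] at hp
    have hiJ : i ≤ J := by omega
    have hh := Finset.mem_Icc.mp (hB hp.1)
    simp only [hT, hg, Finset.coe_product, Set.mem_prod, Finset.mem_coe, Finset.mem_Icc]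
    have hb1 : ∀ j, |(i : ℤ) * u j| ≤ Nv j := fun j => by
      rw [abs_mul, Nat.abs_cast]
      exact (mul_le_mul_of_nonneg_right (by exact_mod_cast hiJ) (abs_nonneg _)).trans (hu j)
    have hb2 : ∀ l, |(i : ℝ) * (Γ l u - v l)| ≤ 1 := fun l => by
      rw [abs_mul, Nat.abs_cast]
      exact (mul_le_mul_of_nonneg_right (by exact_mod_cast hiJ) (abs_nonneg _)).trans (hv l)
    have hz : ∀ l, ((⌊Γ l h⌋ + i * v l - ⌊Γ l (fun j => h j + i * u j)⌋ : ℤ) : ℝ)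
        = -Int.fract (Γ l h) + Int.fract (Γ l (fun j => h j + i * u j))
          - i * (Γ l u - v l) := fun l => by
      rw [Int.fract, Int.fract, hΓadd]
      push_cast
      ring
    refine ⟨⟨fun j => ?_, fun j => ?_⟩, fun l => ?_, fun l => ?_⟩
    · have := hh.1 j; have := (abs_le.mp (hb1 j)).1; dsimp only at *; linarith
    · have := hh.2 j; have := (abs_le.mp (hb1 j)).2; dsimp only at *; linarith
    all_goals
      have h1 := hz l
      have h2 := abs_le.mp (hb2 l)
      have h3 := Int.fract_nonneg (Γ l h)
      have h4 := Int.fract_lt_one (Γ l h)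
      have h5 := Int.fract_nonneg (Γ l (fun j => h j + i * u j))
      have h6 := Int.fract_lt_one (Γ l (fun j => h j + i * u j))
      dsimp only
    · have : ((-2 : ℤ) : ℝ) < ((⌊Γ l h⌋ + i * v l - ⌊Γ l (fun j => h j + i * u j)⌋ : ℤ) : ℝ) := by
        rw [h1]; push_cast; linarith
      have := Int.cast_lt.mp this
      omega
    · have : ((⌊Γ l h⌋ + i * v l - ⌊Γ l (fun j => h j + i * u j)⌋ : ℤ) : ℝ) < ((2 : ℤ) : ℝ) := by
        rw [h1]; push_cast; linarith
      have := Int.cast_lt.mp this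
      omega
  have key : ∀ p ∈ B ×ˢ Finset.range (J + 1), ∀ p' ∈ B ×ˢ Finset.range (J + 1),
      g p = g p' → p.2 < p'.2 → ∃ q : ℕ, 0 < q ∧ q ≤ J ∧
      fracNorm (q * (∑ j, α j * (u j : ℝ) + ∑ l, ζ l * (Γ l u - v l))) ≤ 2 * ε := by
    rintro ⟨h, i⟩ hp ⟨h', i'⟩ hp' heq hlt
    simp only [Finset.mem_product, Finset.mem_range] at hp hp' hlt
    refine ⟨i' - i, by omega, by omega, ?_⟩
    simp only [hg, Prod.mk.injEq] at heq
    obtain ⟨e1, e2⟩ := heq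
    have e3 : ∀ j, (h j : ℝ) - h' j = ((i' : ℝ) - i) * u j := fun j => by
      have := congrArg (Int.cast : ℤ → ℝ) (congrFun e1 j)
      push_cast at this
      linarith
    have e4 : ∀ l, (⌊Γ l h⌋ : ℝ) - ⌊Γ l h'⌋ = ((i' : ℝ) - i) * v l := fun l => by
      have := congrFun e2 l
      rw [e1] at this
      have := congrArg (Int.cast : ℤ → ℝ) this
      push_cast at this
      linarith
    have e5 : ∀ l, Γ l h - Γ l h' = ((i' : ℝ) - i) * Γ l u := fun l => by
      simp only [hΓ, Finset.mul_sum]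
      rw [← Finset.sum_sub_distrib]
      refine Finset.sum_congr rfl fun j _ => ?_
      rw [← mul_sub, e3]
      ring
    have hsub := fracNorm_sub_le
      (β + (∑ j, α j * (h j : ℝ)) + ∑ l, ζ l * Int.fract (Γ l h))
      (β + (∑ j, α j * (h' j : ℝ)) + ∑ l, ζ l * Int.fract (Γ l h'))
    have hrw : (β + (∑ j, α j * (h j : ℝ)) + ∑ l, ζ l * Int.fract (Γ l h))
        - (β + (∑ j, α j * (h' j : ℝ)) + ∑ l, ζ l * Int.fract (Γ l h'))
        = ((i' - i : ℕ) : ℝ) * (∑ j, α j * (u j : ℝ) + ∑ l, ζ l * (Γ l u - v l)) := by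
      have r1 : (∑ j, α j * (h j : ℝ)) - (∑ j, α j * (h' j : ℝ))
          = ((i' : ℝ) - i) * ∑ j, α j * (u j : ℝ) := by
        rw [← Finset.sum_sub_distrib, Finset.mul_sum]
        refine Finset.sum_congr rfl fun j _ => ?_
        rw [← mul_sub, e3]
        ring
      have r2 : (∑ l, ζ l * Int.fract (Γ l h)) - (∑ l, ζ l * Int.fract (Γ l h'))
          = ((i' : ℝ) - i) * ∑ l, ζ l * (Γ l u - v l) := by
        rw [← Finset.sum_sub_distrib, Finset.mul_sum]
        refine Finset.sum_congr rfl fun l _ => ?_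
        rw [Int.fract, Int.fract]
        linear_combination ζ l * (e5 l) - ζ l * (e4 l)
      rw [Nat.cast_sub hlt.le]
      linear_combination r1 + r2
    rw [hrw] at hsub
    have := hf h hp.1
    have := hf h' hp'.1
    simp only [hΓ] at *
    linarith
  obtain ⟨p, hp, p', hp', hne, heq⟩ :=
    Finset.exists_ne_map_eq_of_card_lt_of_maps_to hcard hmaps
  rcases lt_trichotomy p.2 p'.2 with h | h | h
  · exact key p hp p' hp' heq h
  · refine absurd (Prod.ext (funext fun j => ?_) h) hne
    have := congrFun (congrArg Prod.fst heq) j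
    simp only [hg, h] at this
    linarith
  · exact key p' hp' p hp heq.symm h

/-- If moreover some small `h` maps under `γ` very close to `1 / (2J)` times the `l`-th basis
vector, then a bounded multiple of `ζ l` is nearly integral. -/
theorem exists_natCast_mul_coord_fracNorm_le {m t : ℕ} (β : ℝ) (α : Fin t → ℝ)
    (ζ : Fin m → ℝ) (γ : Fin t → Fin m → ℝ) (ε : ℝ) (Nv : Fin t → ℕ) (hN : ∀ j, 1 ≤ Nv j)
    (B : Finset (Fin t → ℤ))
    (hB : B ⊆ Finset.Icc (fun j => -(Nv j : ℤ)) (fun j => (Nv j : ℤ)))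
    (hf : ∀ h ∈ B, fracNorm (β + (∑ j, α j * (h j : ℝ))
      + ∑ l, ζ l * Int.fract (∑ j, γ j l * (h j : ℝ))) ≤ ε) (hε : 0 ≤ ε)
    (J : ℕ) (hJ1 : 1 ≤ J) (hJ : (5 : ℝ) ^ t * 3 ^ m * ∏ j, (Nv j : ℝ) < B.card * (J + 1))
    (l : Fin m) (h : Fin t → ℕ) (hh : ∀ j, 2 * J ^ 2 * h j ≤ Nv j)
    (hx : ∀ i, fracNorm (∑ j, γ j i * (h j : ℝ) - Pi.single (M := fun _ => ℝ) l (1 / (2 * J : ℝ)) i)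
      ≤ 1 / (2 * (J : ℝ) ^ 2)) :
    ∃ q : ℕ, 0 < q ∧ q ≤ J ^ 2 ∧ fracNorm (q * ζ l) ≤ 6 * (J : ℝ) ^ 2 * ε := by
  have hJpos : (1 : ℝ) ≤ J := by exact_mod_cast hJ1
  have hJ0 : (0 : ℝ) < J := by linarith
  set x : Fin m → ℝ := Pi.single l (1 / (2 * J : ℝ)) with hxdef
  set v : Fin m → ℤ := fun i => round (∑ j, γ j i * (h j : ℝ) - x i) with hv
  set e : Fin m → ℤ := Pi.single l 1 with he
  have hxe : ∀ i, 2 * (J : ℝ) * x i = e i := by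
    intro i
    by_cases hi : i = l
    · subst hi
      simp only [hxdef, he, Pi.single_eq_same]
      push_cast
      field_simp
    · simp [hxdef, he, hi]
  have hx0 : ∀ i, |x i| ≤ 1 / (2 * J) := by
    intro i
    by_cases hi : i = l
    · subst hi
      simp only [hxdef, Pi.single_eq_same]
      rw [abs_of_nonneg (by positivity)]
    · simp only [hxdef, Pi.single_eq_of_ne hi, abs_zero]
      positivity
  have hclose : ∀ i, |∑ j, γ j i * (h j : ℝ) - x i - v i| ≤ 1 / (2 * (J : ℝ) ^ 2) := hx
  obtain ⟨q, hq0, hqJ, hq⟩ := exists_natCast_mul_increment_fracNorm_le β α ζ γ ε Nv hN B hB hf J hJ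
    (fun j => h j) v
    (fun j => by
      rw [Nat.abs_cast]
      have := hh j
      have h2 : J * h j ≤ 2 * J ^ 2 * h j := Nat.mul_le_mul_right _ (by nlinarith)
      exact_mod_cast h2.trans this)
    (fun i => by
      push_cast
      have h1 := abs_add_le (∑ j, γ j i * (h j : ℝ) - x i - v i) (x i)
      have h2 := hclose i
      have h3 := hx0 i
      have h4 : 1 / (2 * (J : ℝ) ^ 2) ≤ 1 / (2 * J) := by
        apply one_div_le_one_div_of_le (by positivity); nlinarith
      rw [show ∑ j, γ j i * (h j : ℝ) - x i - v i + x i = ∑ j, γ j i * (h j : ℝ) - v i by ring] at h1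
      calc J * |∑ j, γ j i * (h j : ℝ) - v i| ≤ J * (1 / (2 * J) + 1 / (2 * J)) := by
            gcongr; linarith
        _ = 1 := by field_simp; norm_num)
  obtain ⟨q', hq0', hqJ', hq'⟩ := exists_natCast_mul_increment_fracNorm_le β α ζ γ ε Nv hN B hB hf
    J hJ (fun j => -(2 * J * h j)) (fun i => -e i - 2 * J * v i)
    (fun j => by
      rw [abs_neg, abs_of_nonneg (by positivity)]
      have := hh j
      have h2 : J * (2 * J * h j) ≤ Nv j := by nlinarith
      exact_mod_cast h2)
    (fun i => by
      have h1 : ∑ j, γ j i * (((-(2 * J * h j) : ℤ)) : ℝ) - ((-e i - 2 * J * v i : ℤ) : ℝ)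
          = -(2 * J * (∑ j, γ j i * (h j : ℝ) - x i - v i)) := by
        have : ∑ j, γ j i * (((-(2 * J * h j) : ℤ)) : ℝ)
            = -(2 * J * ∑ j, γ j i * (h j : ℝ)) := by
          rw [Finset.mul_sum, ← Finset.sum_neg_distrib]
          exact Finset.sum_congr rfl fun j _ => by push_cast; ring
        rw [this]
        push_cast
        linear_combination -hxe i
      rw [h1, abs_neg, abs_mul, abs_of_nonneg (by positivity)]
      calc J * (2 * J * |∑ j, γ j i * (h j : ℝ) - x i - v i|)
          ≤ J * (2 * J * (1 / (2 * (J : ℝ) ^ 2))) := by gcongr; exact hclose i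
        _ = 1 := by field_simp)
  set F := ∑ j, α j * (((h j : ℤ)) : ℝ) + ∑ i, ζ i * (∑ j, γ j i * (((h j : ℤ)) : ℝ) - v i) with hF
  set F' := ∑ j, α j * (((-(2 * J * h j) : ℤ)) : ℝ)
    + ∑ i, ζ i * (∑ j, γ j i * (((-(2 * J * h j) : ℤ)) : ℝ) - ((-e i - 2 * J * v i : ℤ) : ℝ)) with hF'
  have hrel : F' = -(2 * J) * F + ζ l := by
    have r0 : ∀ c : Fin t → ℝ, ∑ j, c j * (((-(2 * J * h j) : ℤ)) : ℝ)
        = -(2 * J) * ∑ j, c j * (((h j : ℤ)) : ℝ) := fun c => by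
      rw [Finset.mul_sum]
      exact Finset.sum_congr rfl fun j _ => by push_cast; ring
    have r1 : ∑ i, ζ i * (e i : ℝ) = ζ l := by
      rw [Finset.sum_eq_single l]
      · simp [he]
      · intro i _ hi; simp [he, hi]
      · simp
    rw [hF', hF, ← r1, r0, mul_add, add_assoc]
    congr 1
    rw [Finset.mul_sum, ← Finset.sum_add_distrib]
    refine Finset.sum_congr rfl fun i _ => ?_
    rw [r0]
    push_cast
    ring
  refine ⟨q * q', Nat.mul_pos hq0 hq0', ?_, ?_⟩
  · rw [sq]; exact Nat.mul_le_mul hqJ hqJ'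
  · have h1 : ((q * q' : ℕ) : ℝ) * ζ l = (q : ℕ) * (q' * F') + ((2 * J * q' : ℕ) : ℝ) * (q * F) := by
      rw [hrel]; push_cast; ring
    rw [h1]
    have h2 := fracNorm_natCast_mul_le q (q' * F')
    have h3 := fracNorm_natCast_mul_le (2 * J * q') (q * F)
    have hqr : (q : ℝ) ≤ J := by exact_mod_cast hqJ
    have hqr' : (q' : ℝ) ≤ J := by exact_mod_cast hqJ'
    calc _ ≤ _ := fracNorm_add_le _ _
      _ ≤ q * (2 * ε) + ((2 * J * q' : ℕ) : ℝ) * (2 * ε) := by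
          refine add_le_add (h2.trans ?_) (h3.trans ?_) <;> gcongr
      _ ≤ J * (2 * ε) + (2 * J * J) * (2 * ε) := by push_cast; gcongr
      _ ≤ 6 * (J : ℝ) ^ 2 * ε := by nlinarith [mul_nonneg (mul_nonneg hJ0.le (sub_nonneg.2 hJpos)) hε]

/-- The degree `c * J ^ 8` with `c = (2m + 1)! * 2 ^ (m + 1)` is large enough for
`exists_fracNorm_le_of_no_relation` at scale `1 / (2J²)`. -/
theorem one_sub_pow_add_lt (m J : ℕ) (hJ : 1 ≤ J) (n : ℕ)
    (hn : n = (2 * m + 1).factorial * 2 ^ (m + 1) * J ^ 8) :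
    (1 - 4 * (1 / (2 * (J : ℝ) ^ 2)) ^ 2) ^ n + 1 / (4 * (n + 1 : ℝ) ^ m)
      < 1 / (n + 1 : ℝ) ^ m := by
  set c : ℕ := (2 * m + 1).factorial * 2 ^ (m + 1) with hc
  have hc1 : 1 ≤ c := Nat.mul_pos (Nat.factorial_pos _) (by positivity)
  have hJr : (1 : ℝ) ≤ J := by exact_mod_cast hJ
  have hcr : (1 : ℝ) ≤ c := by exact_mod_cast hc1
  have hnr : (n : ℝ) = c * J ^ 8 := by rw [hn]; push_cast; ring
  have hn1 : (1 : ℝ) ≤ n := by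
    rw [hnr]; exact one_le_mul_of_one_le_of_one_le hcr (one_le_pow₀ hJr)
  set z : ℝ := c * J ^ 4 with hz
  have h1 : (1 - 4 * (1 / (2 * (J : ℝ) ^ 2)) ^ 2) ^ n ≤ Real.exp (-z) := by
    have h4 : 4 * (1 / (2 * (J : ℝ) ^ 2)) ^ 2 = 1 / (J : ℝ) ^ 4 := by field_simp; norm_num
    rw [h4]
    have hle : 1 / (J : ℝ) ^ 4 ≤ 1 := by
      rw [div_le_one (by positivity)]; exact one_le_pow₀ hJr
    have := pow_le_pow_left₀ (by linarith) (Real.one_sub_le_exp_neg (1 / (J : ℝ) ^ 4)) n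
    rw [← Real.exp_nat_mul] at this
    refine this.trans_eq ?_
    congr 1
    rw [hnr, hz]
    field_simp
  have h2 : 2 * (n + 1 : ℝ) ^ m ≤ Real.exp z := by
    refine le_trans ?_ (Real.pow_div_factorial_le_exp (x := z) (by positivity) (2 * m + 1))
    rw [le_div_iff₀ (by positivity)]
    have hz1 : (c : ℝ) ≤ z := le_mul_of_one_le_right (by linarith) (one_le_pow₀ hJr)
    have hz2 : (n : ℝ) ≤ z ^ 2 := by
      rw [hnr, hz, mul_pow, ← pow_mul]
      gcongr
      nlinarith
    calc 2 * (n + 1 : ℝ) ^ m * (2 * m + 1).factorial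
        ≤ 2 * (2 * n : ℝ) ^ m * (2 * m + 1).factorial := by gcongr; linarith
      _ = c * (n : ℝ) ^ m := by rw [hc]; push_cast; ring
      _ ≤ z * (z ^ 2) ^ m := by gcongr
      _ = z ^ (2 * m + 1) := by rw [← pow_mul]; ring
  have hp : (0 : ℝ) < (n + 1 : ℝ) ^ m := by positivity
  have h3 : Real.exp (-z) ≤ 1 / (2 * (n + 1 : ℝ) ^ m) := by
    rw [Real.exp_neg, ← one_div]
    exact one_div_le_one_div_of_le (by positivity) h2
  have h4 : 1 / (2 * (n + 1 : ℝ) ^ m) + 1 / (4 * (n + 1 : ℝ) ^ m)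
      = 3 / 4 * (1 / (n + 1 : ℝ) ^ m) := by field_simp; norm_num
  have h5 : 0 < 1 / (n + 1 : ℝ) ^ m := by positivity
  linarith

/-- The conclusion of the main theorem with all bounds replaced by a single quantity `Q` which
dominates an explicit polynomial in `J` and `1 / δ`. -/
theorem rational_or_relation {m t : ℕ} (hm : 1 ≤ m) (β : ℝ) (α : Fin t → ℝ) (ζ : Fin m → ℝ)
    (γ : Fin t → Fin m → ℝ) (δ N : ℝ) (hδ : 0 < δ) (hδ1 : δ < 1) (hN1 : 1 ≤ N) (Nv : Fin t → ℕ)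
    (hN : ∀ j, 1 ≤ Nv j) (B : Finset (Fin t → ℤ))
    (hB : B ⊆ Finset.Icc (fun j => -(Nv j : ℤ)) (fun j => (Nv j : ℤ)))
    (hf : ∀ h ∈ B, fracNorm (β + (∑ j, α j * (h j : ℝ))
      + ∑ l, ζ l * Int.fract (∑ j, γ j l * (h j : ℝ))) ≤ 1 / (δ * N))
    (J : ℕ) (hJ1 : 1 ≤ J) (hJ : (5 : ℝ) ^ t * 3 ^ m * ∏ j, (Nv j : ℝ) < B.card * (J + 1))
    (c : ℕ) (hc : c = (2 * m + 1).factorial * 2 ^ (m + 1)) (Q : ℝ)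
    (hQ : 6 * (2 * c : ℝ) ^ m * J ^ (8 * m + 2) / δ ≤ Q) :
    (∃ r : ℤ, 0 < r ∧ (r : ℝ) ≤ Q ∧ ∀ l, fracNorm ((r : ℝ) * ζ l) ≤ Q / N) ∨
      (∃ k : Fin m → ℤ, k ≠ 0 ∧ (∀ l, (|k l| : ℝ) ≤ Q) ∧
        ∀ j, fracNorm (∑ l, (k l : ℝ) * γ j l) ≤ Q / (Nv j : ℝ)) := by
  have hJr : (1 : ℝ) ≤ J := by exact_mod_cast hJ1
  have hc1 : 1 ≤ c := hc ▸ Nat.mul_pos (Nat.factorial_pos _) (by positivity)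
  have hcr : (1 : ℝ) ≤ c := by exact_mod_cast hc1
  have hcm : (1 : ℝ) ≤ (2 * c : ℝ) ^ m := one_le_pow₀ (by linarith)
  set P : ℝ := (2 * c : ℝ) ^ m * J ^ (8 * m + 2) with hP
  have hP0 : 0 < P := by positivity
  have hQ1 : 6 * P / δ ≤ Q := by rw [hP]; convert hQ using 2; ring
  have hQ2 : 6 * P ≤ Q := le_trans (le_div_self (by positivity) hδ hδ1.le) hQ1
  refine or_iff_not_imp_right.mpr fun hno => ?_
  push Not at hno
  set n : ℕ := c * J ^ 8 with hn
  have hn1 : 1 ≤ n := Nat.mul_pos hc1 (by positivity)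
  have hnr : (1 : ℝ) ≤ n := by exact_mod_cast hn1
  have hnP : 4 * (J : ℝ) ^ 2 * (n + 1 : ℝ) ^ m ≤ 4 * P := by
    calc 4 * (J : ℝ) ^ 2 * (n + 1 : ℝ) ^ m ≤ 4 * (J : ℝ) ^ 2 * (2 * n : ℝ) ^ m := by
          gcongr; linarith
      _ = 4 * P := by rw [hP, hn]; push_cast; ring
  have hnP' : (n : ℝ) ≤ P := by
    have h1 : (n : ℝ) ≤ (n + 1 : ℝ) ^ m := by
      calc (n : ℝ) ≤ n + 1 := by linarith
        _ ≤ (n + 1 : ℝ) ^ m := le_self_pow₀ (by linarith) (by omega)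
    have h2 : (n + 1 : ℝ) ^ m ≤ (J : ℝ) ^ 2 * (n + 1 : ℝ) ^ m :=
      le_mul_of_one_le_left (by positivity) (one_le_pow₀ hJr)
    linarith
  have hrel : ∀ k : Fin m → ℤ, k ≠ 0 → (∀ l, |k l| ≤ n) →
      ∃ j, 1 ≤ 2 * (1 / (4 * (n + 1 : ℝ) ^ m)) * ((Nv j / (2 * J ^ 2) + 1 : ℕ) : ℝ)
        * fracNorm (∑ l, k l * γ j l) := by
    intro k hk hkn
    obtain ⟨j, hj⟩ := hno k hk fun l => by
      have : (|k l| : ℝ) ≤ n := by exact_mod_cast hkn l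
      linarith
    refine ⟨j, ?_⟩
    have hNj : (1 : ℝ) ≤ Nv j := by exact_mod_cast hN j
    have h1 : (Nv j : ℝ) / (2 * J ^ 2) ≤ ((Nv j / (2 * J ^ 2) + 1 : ℕ) : ℝ) := by
      have h := Nat.lt_div_mul_add (a := Nv j) (b := 2 * J ^ 2) (by positivity)
      rw [div_le_iff₀ (by positivity)]
      have h' : Nv j ≤ (Nv j / (2 * J ^ 2) + 1) * (2 * J ^ 2) := by
        rw [add_mul, one_mul]; exact h.le
      exact_mod_cast h'
    rw [div_lt_iff₀ (by linarith)] at hj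
    have hnn : (0 : ℝ) < (n + 1 : ℝ) ^ m := by positivity
    have hf0 := fracNorm_nonneg (∑ l, k l * γ j l)
    calc (1 : ℝ) ≤ (fracNorm (∑ l, k l * γ j l) * Nv j) / (4 * (J : ℝ) ^ 2 * (n + 1 : ℝ) ^ m) := by
          rw [le_div_iff₀ (by positivity)]; linarith
      _ = 2 * (1 / (4 * (n + 1 : ℝ) ^ m)) * ((Nv j : ℝ) / (2 * J ^ 2))
          * fracNorm (∑ l, k l * γ j l) := by field_simp
      _ ≤ _ := by gcongr
  have hq : ∀ l, ∃ q : ℕ, 0 < q ∧ q ≤ J ^ 2 ∧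
      fracNorm (q * ζ l) ≤ 6 * (J : ℝ) ^ 2 * (1 / (δ * N)) := by
    intro l
    obtain ⟨h, hh, hx⟩ := exists_fracNorm_le_of_no_relation γ
      (Pi.single (M := fun _ => ℝ) l (1 / (2 * J : ℝ))) (fun j => Nv j / (2 * J ^ 2) + 1)
      (fun j => Nat.succ_pos _) n (1 / (2 * (J : ℝ) ^ 2)) (1 / (4 * (n + 1 : ℝ) ^ m))
      (by positivity) (by positivity) (one_sub_pow_add_lt m J hJ1 n (by rw [hn, hc])) hrel
    refine exists_natCast_mul_coord_fracNorm_le β α ζ γ _ Nv hN B hB hf (by positivity) J hJ1 hJ l h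
      (fun j => ?_) hx
    rw [mul_comm]
    exact (Nat.mul_le_mul_right _ (Nat.lt_succ_iff.mp (hh j))).trans (Nat.div_mul_le_self _ _)
  choose q hq0 hqJ hqζ using hq
  have hprod : ∀ s : Finset (Fin m), ((∏ i ∈ s, q i : ℕ) : ℝ) ≤ (J : ℝ) ^ (2 * m) := by
    intro s
    have h1 : ∏ i ∈ s, q i ≤ (J ^ 2) ^ s.card := Finset.prod_le_pow_card _ _ _ fun i _ => hqJ i
    have h2 : (J ^ 2) ^ s.card ≤ (J ^ 2) ^ m :=
      Nat.pow_le_pow_right (by positivity) (by simpa using Finset.card_le_univ s)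
    rw [pow_mul]
    exact_mod_cast h1.trans h2
  have hJP : (J : ℝ) ^ (2 * m) * (J : ℝ) ^ 2 ≤ P := by
    rw [← pow_add, hP]
    refine le_trans ?_ (le_mul_of_one_le_left (by positivity) hcm)
    exact pow_le_pow_right₀ hJr (by omega)
  refine ⟨((∏ i, q i : ℕ) : ℤ), ?_, ?_, fun l => ?_⟩
  · exact_mod_cast Finset.prod_pos fun i _ => hq0 i
  · have h1 := hprod Finset.univ
    have h2 : (J : ℝ) ^ (2 * m) ≤ (J : ℝ) ^ (2 * m) * (J : ℝ) ^ 2 :=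
      le_mul_of_one_le_right (by positivity) (one_le_pow₀ hJr)
    rw [Int.cast_natCast]
    linarith
  · rw [← Finset.prod_erase_mul _ _ (Finset.mem_univ l), Int.cast_natCast, Nat.cast_mul, mul_assoc]
    refine (fracNorm_natCast_mul_le _ _).trans ?_
    calc _ ≤ (J : ℝ) ^ (2 * m) * (6 * (J : ℝ) ^ 2 * (1 / (δ * N))) :=
          mul_le_mul (hprod _) (hqζ l) (fracNorm_nonneg _) (by positivity)
      _ = 6 * ((J : ℝ) ^ (2 * m) * (J : ℝ) ^ 2) / δ / N := by field_simp
      _ ≤ 6 * P / δ / N := by gcongr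
      _ ≤ Q / N := by gcongr

/-- multiparameter version of Claim 7.7: if `|ζ| ≤ 1/δ` and
`‖β + Σⱼαⱼhⱼ + ζ·{Σⱼγⱼhⱼ}‖_{ℝ/ℤ} ≤ 1/(δN)` for at least `δN₁⋯Nₜ` values of
`h⃗ ∈ [−N⃗,N⃗]`, then either (i) there is `r ∈ ℤ`, `0 < r ≤ Cδ^{-C}`, with
`‖rζ_l‖_{ℝ/ℤ} ≤ Cδ^{-C}/N` for all `l`, or (ii) there is `k ∈ ℤ^m` with
`0 < |k| ≤ Cδ^{-C}` and `‖k·γⱼ‖_{ℝ/ℤ} ≤ Cδ^{-C}/Nⱼ` for all `j`. -/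
theorem stmt10 :
    ∀ m t : ℕ, 1 ≤ m → 1 ≤ t →
      ∃ C : ℝ, 0 < C ∧
        ∀ (β : ℝ) (α : Fin t → ℝ) (ζ : Fin m → ℝ) (γ : Fin t → Fin m → ℝ)
          (δ N : ℝ) (Nv : Fin t → ℕ),
          0 < δ → δ < 1/2 → 1 ≤ N → (∀ j, 1 ≤ Nv j) →
          (∀ l, |ζ l| ≤ 1 / δ) →
          δ * ∏ j, (Nv j : ℝ) ≤
            (((Finset.Icc (fun j => -(Nv j : ℤ)) (fun j => (Nv j : ℤ))).filter
              (fun h : Fin t → ℤ =>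
                fracNorm (β + (∑ j, α j * (h j : ℝ))
                  + ∑ l, ζ l * Int.fract (∑ j, γ j l * (h j : ℝ))) ≤ 1 / (δ * N))).card : ℝ) →
          (∃ r : ℤ, 0 < r ∧ (r : ℝ) ≤ C * δ ^ (-C) ∧
              ∀ l, fracNorm ((r : ℝ) * ζ l) ≤ C * δ ^ (-C) / N) ∨
            (∃ k : Fin m → ℤ, k ≠ 0 ∧ (∀ l, (|k l| : ℝ) ≤ C * δ ^ (-C)) ∧
              ∀ j, fracNorm (∑ l, (k l : ℝ) * γ j l) ≤ C * δ ^ (-C) / (Nv j : ℝ)) := by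
  intro m t hm _
  set c : ℕ := (2 * m + 1).factorial * 2 ^ (m + 1) with hc
  set D : ℝ := 5 ^ t * 3 ^ m with hD
  have hD1 : 1 ≤ D :=
    one_le_mul_of_one_le_of_one_le (one_le_pow₀ (by norm_num)) (one_le_pow₀ (by norm_num))
  set K : ℝ := 6 * (2 * c : ℝ) ^ m * D ^ (8 * m + 2) with hK
  have hK0 : 0 ≤ K := by positivity
  refine ⟨K + (8 * m + 3 : ℕ), by positivity, ?_⟩
  intro β α ζ γ δ N Nv hδ hδ2 hN1 hN _ hcard
  have hprod : (0 : ℝ) < ∏ j, (Nv j : ℝ) :=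
    Finset.prod_pos fun j _ => by exact_mod_cast hN j
  set J : ℕ := ⌊D / δ⌋₊ with hJ
  have hJle : (J : ℝ) ≤ D / δ := Nat.floor_le (by positivity)
  have hJlt : D / δ < J + 1 := Nat.lt_floor_add_one _
  have hJ1 : 1 ≤ J := by
    rw [hJ, Nat.one_le_floor_iff, le_div_iff₀ hδ]
    linarith
  refine rational_or_relation hm β α ζ γ δ N hδ (by linarith) hN1 Nv hN _
    (Finset.filter_subset _ _) (fun h hh => (Finset.mem_filter.mp hh).2) J hJ1 ?_ c hc _ ?_
  · rw [div_lt_iff₀ hδ] at hJlt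
    calc D * ∏ j, (Nv j : ℝ) < (J + 1) * δ * ∏ j, (Nv j : ℝ) := by gcongr
      _ = (δ * ∏ j, (Nv j : ℝ)) * (J + 1) := by ring
      _ ≤ _ := mul_le_mul_of_nonneg_right hcard (by positivity)
  · calc 6 * (2 * c : ℝ) ^ m * (J : ℝ) ^ (8 * m + 2) / δ
        ≤ 6 * (2 * c : ℝ) ^ m * (D / δ) ^ (8 * m + 2) / δ := by gcongr
      _ = K * δ ^ (-((8 * m + 3 : ℕ) : ℝ)) := by
          rw [Real.rpow_neg hδ.le, Real.rpow_natCast, hK, div_pow]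
          field_simp
          ring
      _ ≤ (K + (8 * m + 3 : ℕ)) * δ ^ (-(K + (8 * m + 3 : ℕ))) := by
          refine mul_le_mul (by simp; positivity) ?_ (by positivity) (by positivity)
          exact Real.rpow_le_rpow_of_exponent_ge hδ (by linarith) (by linarith)
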